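/- Let B be an instance of (2,2)-E3-SAT, let J be the TAP-SS instance constructed from B as described, and let J′ be the extended TAP-SS instance obtained from J by the gadget construction described. If B admits a satisfying truth assignment, then J′ admits a stable matching. -/

import Mathlib

/-- The three subjects. -/
inductive Subj : Type where
  | F | I | M
deriving DecidableEq

/-- An instance of (2,2)-E3-SAT with variables `Fin n` and clauses `Fin m`:
`clause j t` is the literal (variable, polarity) in position `t` of clause `j`;
`occurs v b o` is the (clause, position) of the `o`-th occurrence of the literal
`(v, b)`, and `occInv` is its two-sided inverse, so that each clause has exactly
3 literals and each literal occurs exactly twice. -/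
structure E3SAT (n m : ℕ) where
  clause : Fin m → Fin 3 → Fin n × Bool
  occurs : Fin n → Bool → Fin 2 → Fin m × Fin 3
  occInv : Fin m → Fin 3 → Fin n × Bool × Fin 2
  clause_occurs : ∀ v b o, clause (occurs v b o).1 (occurs v b o).2 = (v, b)
  occurs_occInv : ∀ j t, occurs (occInv j t).1 (occInv j t).2.1 (occInv j t).2.2 = (j, t)
  occInv_occurs : ∀ v b o, occInv (occurs v b o).1 (occurs v b o).2 = (v, b, o)

/-- `f` is a satisfying truth assignment of `B`. -/
def E3SAT.Satisfies {n m : ℕ} (B : E3SAT n m) (f : Fin n → Bool) : Prop :=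
  ∀ j : Fin m, ∃ t : Fin 3, f (B.clause j t).1 = (B.clause j t).2
/-- An instance of TAP-SS: like TAP but each school has a separate preference
list of applicants for each subject. -/
structure TAPSS (A : Type*) (S : Type*) (P : Type*) where
  ptype : A → Finset P
  prefA : A → List S
  cap : S → P → ℕ
  prefSp : S → P → List A

namespace TAPSS

variable {A S P : Type*} [DecidableEq A] [DecidableEq S] [DecidableEq P] (J : TAPSS A S P)

def IsAssignment (M : Finset (A × S)) : Prop :=
  (∀ x ∈ M, x.2 ∈ J.prefA x.1) ∧
  ∀ a s s', (a, s) ∈ M → (a, s') ∈ M → s = s'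

def Mp (M : Finset (A × S)) (s : S) (p : P) : Finset A :=
  (M.filter (fun x => x.2 = s ∧ p ∈ J.ptype x.1)).image Prod.fst

def Mpr (M : Finset (A × S)) (s : S) (p r : P) : Finset A :=
  (M.filter (fun x => x.2 = s ∧ J.ptype x.1 = {p, r})).image Prod.fst

def IsMatching (M : Finset (A × S)) : Prop :=
  J.IsAssignment M ∧ ∀ s p, (J.Mp M s p).card ≤ J.cap s p

def Undersub (M : Finset (A × S)) (s : S) (p : P) : Prop :=
  (J.Mp M s p).card < J.cap s p

def PrefersA (a : A) (s s' : S) : Prop :=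
  s ∈ J.prefA a ∧ s' ∈ J.prefA a ∧ (J.prefA a).idxOf s < (J.prefA a).idxOf s'

/-- School `s` prefers `a` to `a'` in subject `p`. -/
def PrefersS (s : S) (p : P) (a a' : A) : Prop :=
  a ∈ J.prefSp s p ∧ a' ∈ J.prefSp s p ∧
    (J.prefSp s p).idxOf a < (J.prefSp s p).idxOf a'

def Unassigned (M : Finset (A × S)) (a : A) : Prop := ∀ s, (a, s) ∉ M

def Blocks (M : Finset (A × S)) (a : A) (s : S) : Prop :=
  s ∈ J.prefA a ∧
  (Unassigned M a ∨ ∃ s', (a, s') ∈ M ∧ J.PrefersA a s s') ∧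
  ∃ p₁ p₂, p₁ ≠ p₂ ∧ J.ptype a = {p₁, p₂} ∧
    ((J.Undersub M s p₁ ∧ J.Undersub M s p₂) ∨
     (J.Undersub M s p₁ ∧ ∃ b ∈ J.Mp M s p₂, J.PrefersS s p₂ a b) ∨
     (J.Undersub M s p₂ ∧ ∃ b ∈ J.Mp M s p₁, J.PrefersS s p₁ a b) ∨
     (∃ b ∈ J.Mpr M s p₁ p₂, J.PrefersS s p₁ a b ∧ J.PrefersS s p₂ a b) ∨
     (∃ b₁ ∈ J.Mp M s p₁, ∃ b₂ ∈ J.Mp M s p₂,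
        b₁ ≠ b₂ ∧ J.PrefersS s p₁ a b₁ ∧ J.PrefersS s p₂ a b₂))

def Stable (M : Finset (A × S)) : Prop :=
  J.IsMatching M ∧ ∀ a s, ¬ J.Blocks M a s

/-- Every applicant is assigned. -/
def ApplicantComplete (_J : TAPSS A S P) (M : Finset (A × S)) : Prop :=
  ∀ a : A, ∃ s, (a, s) ∈ M

end TAPSS
/-- The applicants of the TAP-SS instance constructed from a (2,2)-E3-SAT instance:
`x i r` is the applicant `x_{4i+r}` of the paper, `q j` is `q_{j+1}` and
`w j t` is `w_{j+1}^{t+1}`. -/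
inductive SApp (n m : ℕ) : Type where
  | x (i : Fin n) (r : Fin 4)
  | q (j : Fin m)
  | w (j : Fin m) (t : Fin 3)
deriving DecidableEq

/-- The schools of the TAP-SS instance constructed from a (2,2)-E3-SAT instance:
`y i r` is the school `y_{4i+r}` of the paper, `s j t` is `s_{j+1}^{t+1}` and
`s4 j` is `s_{j+1}^4`. -/
inductive SSch (n m : ℕ) : Type where
  | y (i : Fin n) (r : Fin 4)
  | s (j : Fin m) (t : Fin 3)
  | s4 (j : Fin m)
deriving DecidableEq

variable {n m : ℕ}

/-- The school `s(x_{4i+r})` housing the literal occurrence that applicant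
`x_{4i+r}` corresponds to. -/
def sx (B : E3SAT n m) (i : Fin n) (r : Fin 4) : SSch n m :=
  if h : r.1 < 2 then
    SSch.s (B.occurs i true ⟨r.1, h⟩).1 (B.occurs i true ⟨r.1, h⟩).2
  else
    SSch.s (B.occurs i false ⟨r.1 - 2, by have := r.2; omega⟩).1
      (B.occurs i false ⟨r.1 - 2, by have := r.2; omega⟩).2

open Subj in
/-- Types of the applicants: all x-applicants are FI, all q- and w-applicants are FM. -/
def ssPtype : SApp n m → Finset Subj
  | .x _ _ => {F, I}
  | .q _ => {F, M}
  | .w _ _ => {F, M}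

/-- Preference lists of the applicants. -/
def ssPrefA (B : E3SAT n m) : SApp n m → List (SSch n m)
  | .x i r =>
      if r = 0 then [.y i 0, sx B i r, .y i 1]
      else if r = 1 then [.y i 1, sx B i r, .y i 2]
      else if r = 2 then [.y i 3, sx B i r, .y i 2]
      else [.y i 0, sx B i r, .y i 3]
  | .q j => [.s j 0, .s j 1, .s j 2]
  | .w j t => [.s j t, .s4 j]

open Subj in
/-- Capacities of the schools. -/
def ssCap : SSch n m → Subj → ℕ
  | .y _ _, p => if p = M then 0 else 1
  | .s _ _, _ => 1
  | .s4 _, p => if p = I then 0 else 1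

/-- `⟨X⟩`: the x-applicants in increasing subscript order. -/
def Xlist (n m : ℕ) : List (SApp n m) :=
  (List.finRange n).flatMap fun i => (List.finRange 4).map fun r => SApp.x i r

/-- `⟨Q⟩`: the q-applicants in increasing subscript order. -/
def Qlist (n m : ℕ) : List (SApp n m) := (List.finRange m).map SApp.q

/-- `⟨W⟩`: the w-applicants ordered by increasing subscript and, within equal
subscript, increasing superscript. -/
def Wlist (n m : ℕ) : List (SApp n m) :=
  (List.finRange m).flatMap fun j => (List.finRange 3).map fun t => SApp.w j t

open Subj in
/-- The subject-specific master lists of applicants: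
F: ⟨W⟩ ⟨X⟩ ⟨Q⟩; I: ⟨X̄⟩; M: ⟨Q⟩ ⟨W̄⟩. -/
def ssMaster (n m : ℕ) : Subj → List (SApp n m)
  | F => Wlist n m ++ Xlist n m ++ Qlist n m
  | I => (Xlist n m).reverse
  | M => Qlist n m ++ (Wlist n m).reverse

/-- The TAP-SS instance `J` constructed from the (2,2)-E3-SAT instance `B`;
each school's preference list for subject `p` is the restriction of the master
list for `p` to the applicants whose type includes `p` and who find the school
acceptable. -/
def ssOf (B : E3SAT n m) : TAPSS (SApp n m) (SSch n m) Subj where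
  ptype := ssPtype
  prefA := ssPrefA B
  cap s p := ssCap s p
  prefSp s p := (ssMaster n m p).filter
    (fun a => decide (s ∈ ssPrefA B a) && decide (p ∈ ssPtype a))

/-- The set of pairs `T_i = {(x_{4i+r}, y_{4i+r}) : 0 ≤ r ≤ 3}`. -/
def ssT (i : Fin n) : Finset (SApp n m × SSch n m) :=
  {(.x i 0, .y i 0), (.x i 1, .y i 1), (.x i 2, .y i 2), (.x i 3, .y i 3)}

/-- The set of pairs `F_i = {(x_{4i+r}, y_{4i+r+1}) : 0 ≤ r ≤ 2} ∪ {(x_{4i+3}, y_{4i})}`. -/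
def ssF (i : Fin n) : Finset (SApp n m × SSch n m) :=
  {(.x i 0, .y i 1), (.x i 1, .y i 2), (.x i 2, .y i 3), (.x i 3, .y i 0)}
/-- The applicants of the extended instance `J′`: `base a` is an original applicant
`a` of `J`, and `p1 a`, `p2 a` are the new applicants `a′` and `a″`. -/
inductive SApp' (n m : ℕ) : Type where
  | base (a : SApp n m)
  | p1 (a : SApp n m)
  | p2 (a : SApp n m)
deriving DecidableEq

/-- The schools of the extended instance `J′`: `base s` is an original school of
`J`, and `g a` is the new school `g(a)` for each original applicant `a`. -/
inductive SSch' (n m : ℕ) : Type where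
  | base (s : SSch n m)
  | g (a : SApp n m)
deriving DecidableEq

open Subj in
/-- Types in `J′`: original applicants keep their types; if `a` has type FI then
`a′` has type FM, and if `a` has type FM then `a′` has type FI; `a″` always has
type IM. -/
def ssPtype' : SApp' n m → Finset Subj
  | .base a => ssPtype a
  | .p1 a => match a with
      | .x _ _ => {F, M}
      | _ => {F, I}
  | .p2 _ => {I, M}

/-- Preference lists in `J′`: `g a` is appended to `a`'s preference list, and the
new applicants `a′`, `a″` find only `g a` acceptable. -/
def ssPrefA' (B : E3SAT n m) : SApp' n m → List (SSch' n m)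
  | .base a => (ssPrefA B a).map SSch'.base ++ [.g a]
  | .p1 a => [.g a]
  | .p2 a => [.g a]

/-- Capacities in `J′`: original schools keep their capacities and each new school
`g a` has capacity 1 in every subject. -/
def ssCap' : SSch' n m → Subj → ℕ
  | .base s, p => ssCap s p
  | .g _, _ => 1

open Subj in
/-- The subject-specific master lists of `J′`:
F: ⟨W⟩ ⟨X⟩ ⟨Q⟩ ⟨X′⟩ ⟨R′⟩; I: ⟨X″⟩ ⟨R′⟩ ⟨R″⟩ ⟨X̄⟩; M: ⟨R″⟩ ⟨Q⟩ ⟨W̄⟩ ⟨X′⟩ ⟨X″⟩,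
where `LX1 = ⟨X′⟩`, `LX2 = ⟨X″⟩`, `LR1 = ⟨R′⟩`, `LR2 = ⟨R″⟩` are the chosen fixed
orderings of the sets of new applicants. -/
def ssMaster' (n m : ℕ) (LX1 LX2 LR1 LR2 : List (SApp' n m)) : Subj → List (SApp' n m)
  | F => (Wlist n m ++ Xlist n m ++ Qlist n m).map SApp'.base ++ LX1 ++ LR1
  | I => LX2 ++ LR1 ++ LR2 ++ ((Xlist n m).reverse).map SApp'.base
  | M => LR2 ++ (Qlist n m ++ (Wlist n m).reverse).map SApp'.base ++ LX1 ++ LX2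

/-- The extended TAP-SS instance `J′` constructed from `B` (with chosen orderings
of the new applicants); each school's preference list for subject `p` is the
restriction of the master list for `p` to the applicants whose type includes `p`
and who find the school acceptable. -/
def ssOf' (B : E3SAT n m) (LX1 LX2 LR1 LR2 : List (SApp' n m)) :
    TAPSS (SApp' n m) (SSch' n m) Subj where
  ptype := ssPtype'
  prefA := ssPrefA' B
  cap s p := ssCap' s p
  prefSp s p := (ssMaster' n m LX1 LX2 LR1 LR2 p).filter
    (fun a => decide (s ∈ ssPrefA' B a) && decide (p ∈ ssPtype' a))

/-- The hypothesis that `LX1, LX2, LR1, LR2` are indeed orderings of the sets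
`X′`, `X″`, `R′` and `R″` respectively. -/
def ssOrderings (n m : ℕ) (LX1 LX2 LR1 LR2 : List (SApp' n m)) : Prop :=
  LX1.Perm ((Xlist n m).map SApp'.p1) ∧ LX2.Perm ((Xlist n m).map SApp'.p2) ∧
  LR1.Perm ((Qlist n m ++ Wlist n m).map SApp'.p1) ∧
  LR2.Perm ((Qlist n m ++ Wlist n m).map SApp'.p2)
namespace TAPSS

/-- If the preference list is sorted with respect to `rank`, preference implies smaller rank. -/
lemma PrefersS.rank_le {A S P : Type*} [DecidableEq A] {J : TAPSS A S P} {s : S} {p : P}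
    {a b : A} {rank : A → ℕ}
    (hsorted : (J.prefSp s p).Pairwise fun c d => rank c ≤ rank d)
    (h : J.PrefersS s p a b) : rank a ≤ rank b := by
  obtain ⟨ha, hb, hlt⟩ := h
  have := List.pairwise_iff_getElem.1 hsorted _ _ (List.idxOf_lt_length_of_mem ha)
    (List.idxOf_lt_length_of_mem hb) hlt
  simpa using this

variable {A S P : Type*} [DecidableEq A] [DecidableEq S] [DecidableEq P] (J : TAPSS A S P)

lemma mem_Mp {M : Finset (A × S)} {s : S} {p : P} {b : A} :
    b ∈ J.Mp M s p ↔ (b, s) ∈ M ∧ p ∈ J.ptype b := by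
  simp [Mp]

lemma mem_Mpr {M : Finset (A × S)} {s : S} {p r : P} {b : A} :
    b ∈ J.Mpr M s p r ↔ (b, s) ∈ M ∧ J.ptype b = {p, r} := by
  simp [Mpr]

/-- A pair `(a, s)` does not block if `s` has a unique occupant `b` which fills the capacity of
some subject of `a`, and `s` does not prefer `a` to `b` in that subject. -/
lemma not_blocks_of_occupant {M : Finset (A × S)} {a b : A} {s : S} {p : P}
    (hb : (b, s) ∈ M) (huniq : ∀ b', (b', s) ∈ M → b' = b) (hpa : p ∈ J.ptype a)
    (hpb : p ∈ J.ptype b) (hcap : J.cap s p ≤ 1) (hpref : ¬ J.PrefersS s p a b) :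
    ¬ J.Blocks M a s := by
  have hfull : ¬ J.Undersub M s p := by
    have hpos : 0 < (J.Mp M s p).card := Finset.card_pos.2 ⟨b, J.mem_Mp.2 ⟨hb, hpb⟩⟩
    unfold Undersub
    omega
  have hMp : ∀ r, ∀ c ∈ J.Mp M s r, c = b := fun r c hc => huniq c (J.mem_Mp.1 hc).1
  rintro ⟨-, -, p₁, p₂, -, htype, h⟩
  rw [htype, Finset.mem_insert, Finset.mem_singleton] at hpa
  rcases h with ⟨h₁, h₂⟩ | ⟨h₁, c, hc, h₂⟩ | ⟨h₂, c, hc, h₁⟩ | ⟨c, hc, h₁, h₂⟩ |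
    ⟨c, hc, d, hd, hne, -, -⟩
  · rcases hpa with rfl | rfl <;> contradiction
  · rw [hMp _ c hc] at h₂
    rcases hpa with rfl | rfl <;> contradiction
  · rw [hMp _ c hc] at h₁
    rcases hpa with rfl | rfl <;> contradiction
  · rw [huniq c (J.mem_Mpr.1 hc).1] at h₁ h₂
    rcases hpa with rfl | rfl <;> contradiction
  · exact hne ((hMp _ c hc).trans (hMp _ d hd).symm)

/-- A matching in which every school holds at most one applicant is stable as soon as every
school that an applicant would rather attend holds an applicant of smaller rank in some
common subject. -/
lemma stable_of_occupants {M : Finset (A × S)} (rank : P → A → ℕ)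
    (hsorted : ∀ s p, (J.prefSp s p).Pairwise fun c d => rank p c ≤ rank p d)
    (hM : J.IsMatching M) (hcap : ∀ s p, J.cap s p ≤ 1)
    (hinj : ∀ a b s, (a, s) ∈ M → (b, s) ∈ M → a = b)
    (hocc : ∀ a s, s ∈ J.prefA a →
      (Unassigned M a ∨ ∃ s', (a, s') ∈ M ∧ J.PrefersA a s s') →
      ∃ b p, (b, s) ∈ M ∧ p ∈ J.ptype a ∧ p ∈ J.ptype b ∧ rank p b < rank p a) :
    J.Stable M := by
  refine ⟨hM, fun a s hblock => ?_⟩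
  obtain ⟨b, p, hb, hpa, hpb, hlt⟩ := hocc a s hblock.1 hblock.2.1
  exact J.not_blocks_of_occupant hb (fun b' hb' => hinj _ _ _ hb' hb) hpa hpb (hcap s p)
    (fun h => (h.rank_le (hsorted s p)).not_gt hlt) hblock

end TAPSS

/-- Ranks witnessing that the master lists of the extended instance are sorted. -/
def ssRank' (n : ℕ) {m : ℕ} : Subj → SApp' n m → ℕ
  | .F, .base (.w _ _) => 0
  | .F, .base (.x i r) => 1 + 4 * i + r
  | .F, .base (.q _) => 4 * n + 1
  | .F, .p1 (.x _ _) => 4 * n + 2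
  | .F, .p1 _ => 4 * n + 3
  | .I, .p2 (.x _ _) => 0
  | .I, .p1 _ => 1
  | .I, .p2 _ => 2
  | .I, .base (.x i r) => 3 + 4 * n - (4 * i + r)
  | .M, .p2 (.q _) => 0
  | .M, .p2 (.w _ _) => 0
  | .M, .base (.q _) => 1
  | .M, .base _ => 2
  | .M, .p1 _ => 3
  | .M, .p2 (.x _ _) => 4
  | _, _ => 0

lemma mem_Xlist {a : SApp n m} : a ∈ Xlist n m ↔ ∃ i r, a = .x i r := by
  simp only [Xlist, List.mem_flatMap, List.mem_finRange, List.mem_map, true_and]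
  grind

lemma mem_Qlist {a : SApp n m} : a ∈ Qlist n m ↔ ∃ j, a = .q j := by
  simp only [Qlist, List.mem_finRange, List.mem_map, true_and]
  grind

lemma mem_Wlist {a : SApp n m} : a ∈ Wlist n m ↔ ∃ j t, a = .w j t := by
  simp only [Wlist, List.mem_flatMap, List.mem_finRange, List.mem_map, true_and]
  grind

lemma pairwise_Xlist : (Xlist n m).Pairwise fun a b => ∃ i r i' r',
    a = .x i r ∧ b = .x i' r' ∧ 4 * i.1 + r.1 < 4 * i'.1 + r'.1 := by
  rw [Xlist, List.pairwise_flatMap]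
  refine ⟨fun i _ => ?_, (List.pairwise_lt_finRange n).imp fun {i i'} hi => ?_⟩
  · rw [List.pairwise_map]
    exact (List.pairwise_lt_finRange 4).imp fun {r r'} hr =>
      ⟨i, r, i, r', rfl, rfl, by have : r.1 < r'.1 := hr; omega⟩
  · simp only [List.mem_map, List.mem_finRange, true_and]
    rintro _ ⟨r, rfl⟩ _ ⟨r', rfl⟩
    exact ⟨i, r, i', r', rfl, rfl, by have : i.1 < i'.1 := hi; omega⟩

lemma pairwise_of_const {α : Type*} {l : List α} {rank : α → ℕ} {k : ℕ}
    (h : ∀ a ∈ l, rank a = k) : l.Pairwise fun a b => rank a ≤ rank b :=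
  List.pairwise_of_forall_mem_list fun a ha b hb => by rw [h a ha, h b hb]

lemma pairwise_ssMaster' {LX1 LX2 LR1 LR2 : List (SApp' n m)}
    (hord : ssOrderings n m LX1 LX2 LR1 LR2) (p : Subj) :
    (ssMaster' n m LX1 LX2 LR1 LR2 p).Pairwise fun a b => ssRank' n p a ≤ ssRank' n p b := by
  obtain ⟨h₁, h₂, h₃, h₄⟩ := hord
  have hX1 : ∀ a ∈ LX1, ∃ i r, a = .p1 (.x i r) := fun a ha => by
    have := h₁.mem_iff.1 ha
    simp only [List.mem_map, mem_Xlist] at this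
    grind
  have hX2 : ∀ a ∈ LX2, ∃ i r, a = .p2 (.x i r) := fun a ha => by
    have := h₂.mem_iff.1 ha
    simp only [List.mem_map, mem_Xlist] at this
    grind
  have hR1 : ∀ a ∈ LR1, (∃ j, a = .p1 (.q j)) ∨ ∃ j t, a = .p1 (.w j t) := fun a ha => by
    have := h₃.mem_iff.1 ha
    simp only [List.mem_map, List.mem_append, mem_Qlist, mem_Wlist] at this
    grind
  have hR2 : ∀ a ∈ LR2, (∃ j, a = .p2 (.q j)) ∨ ∃ j t, a = .p2 (.w j t) := fun a ha => by
    have := h₄.mem_iff.1 ha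
    simp only [List.mem_map, List.mem_append, mem_Qlist, mem_Wlist] at this
    grind
  have constX1 (p k) (h : ∀ i r, ssRank' n p (.p1 (.x i r) : SApp' n m) = k) :
      LX1.Pairwise fun a b => ssRank' n p a ≤ ssRank' n p b :=
    pairwise_of_const (k := k) fun a ha => by grind
  have constX2 (p k) (h : ∀ i r, ssRank' n p (.p2 (.x i r) : SApp' n m) = k) :
      LX2.Pairwise fun a b => ssRank' n p a ≤ ssRank' n p b :=
    pairwise_of_const (k := k) fun a ha => by grind
  have constR1 (p k) (hq : ∀ j, ssRank' n p (.p1 (.q j) : SApp' n m) = k)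
      (hw : ∀ j t, ssRank' n p (.p1 (.w j t) : SApp' n m) = k) :
      LR1.Pairwise fun a b => ssRank' n p a ≤ ssRank' n p b :=
    pairwise_of_const (k := k) fun a ha => by grind
  have constR2 (p k) (hq : ∀ j, ssRank' n p (.p2 (.q j) : SApp' n m) = k)
      (hw : ∀ j t, ssRank' n p (.p2 (.w j t) : SApp' n m) = k) :
      LR2.Pairwise fun a b => ssRank' n p a ≤ ssRank' n p b :=
    pairwise_of_const (k := k) fun a ha => by grind
  have constQ (p k) (h : ∀ j, ssRank' n p (.base (.q j) : SApp' n m) = k) :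
      (Qlist n m).Pairwise fun a b => ssRank' n p (.base a) ≤ ssRank' n p (.base b) :=
    pairwise_of_const (rank := fun a => ssRank' n p (.base a)) fun a ha => by
      obtain ⟨j, rfl⟩ := mem_Qlist.1 ha
      exact h j
  have constW (p k) (h : ∀ j t, ssRank' n p (.base (.w j t) : SApp' n m) = k) :
      (Wlist n m).Pairwise fun a b => ssRank' n p (.base a) ≤ ssRank' n p (.base b) :=
    pairwise_of_const (rank := fun a => ssRank' n p (.base a)) fun a ha => by
      obtain ⟨j, t, rfl⟩ := mem_Wlist.1 ha
      exact h j t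
  cases p
  · simp only [ssMaster', List.pairwise_append, List.pairwise_map, List.mem_append, List.mem_map,
      mem_Xlist, mem_Qlist, mem_Wlist]
    refine ⟨⟨⟨⟨constW _ 0 fun _ _ => rfl, ?_, ?_⟩, constQ _ _ fun _ => rfl, ?_⟩,
      constX1 _ _ fun _ _ => rfl, ?_⟩, constR1 _ _ (fun _ => rfl) fun _ _ => rfl, ?_⟩
    · refine pairwise_Xlist.imp ?_
      rintro _ _ ⟨i, r, i', r', rfl, rfl, h⟩
      simp only [ssRank']
      omega
    all_goals grind [ssRank']
  · simp only [ssMaster', List.pairwise_append, List.pairwise_map, List.mem_append, List.mem_map,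
      List.mem_reverse, List.pairwise_reverse, mem_Xlist]
    refine ⟨⟨⟨constX2 _ 0 fun _ _ => rfl, constR1 _ _ (fun _ => rfl) fun _ _ => rfl, ?_⟩,
      constR2 _ _ (fun _ => rfl) fun _ _ => rfl, ?_⟩, ?_, ?_⟩
    pick_goal 3
    · refine pairwise_Xlist.imp ?_
      rintro _ _ ⟨i, r, i', r', rfl, rfl, h⟩
      simp only [ssRank']
      omega
    all_goals grind [ssRank']
  · simp only [ssMaster', List.pairwise_append, List.pairwise_map, List.mem_append, List.mem_map,
      List.mem_reverse, List.pairwise_reverse, mem_Qlist, mem_Wlist]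
    refine ⟨⟨⟨constR2 _ 0 (fun _ => rfl) fun _ _ => rfl,
      ⟨constQ _ _ fun _ => rfl, ?_, ?_⟩, ?_⟩, constX1 _ _ fun _ _ => rfl, ?_⟩,
      constX2 _ _ fun _ _ => rfl, ?_⟩
    · refine (constW .M 2 fun _ _ => rfl).imp_of_mem fun {a b} ha hb _ => ?_
      obtain ⟨_, _, rfl⟩ := mem_Wlist.1 ha
      obtain ⟨_, _, rfl⟩ := mem_Wlist.1 hb
      exact le_rfl
    all_goals grind [ssRank']

lemma idxOf_map {α β : Type*} [DecidableEq α] [DecidableEq β] {g : α → β}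
    (hg : Function.Injective g) (a : α) (l : List α) : (l.map g).idxOf (g a) = l.idxOf a := by
  induction l with
  | nil => rfl
  | cons b l ih => simp [List.idxOf_cons, ih, beq_eq_decide, hg.eq_iff]

/-- The school assigned to each original applicant, given a truth assignment `f` and the position
`t j` of a true literal in each clause `c_j`. -/
def ssAssign (f : Fin n → Bool) (t : Fin m → Fin 3) : SApp n m → SSch n m
  | .x i r => if f i then .y i r else .y i (r + 1)
  | .q j => .s j (t j)
  | .w j u => if u = t j then .s4 j else .s j u

lemma ssAssign_injective (f : Fin n → Bool) (t : Fin m → Fin 3) :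
    Function.Injective (ssAssign f t) := by
  intro a b h
  rcases a with ⟨i, r⟩ | j | ⟨j, u⟩ <;> rcases b with ⟨i', r'⟩ | j' | ⟨j', u'⟩ <;>
    simp only [ssAssign] at h <;> (try split_ifs at h) <;> grind

/-- The matching of the extended instance given by `ssAssign` on the original applicants and by
assigning `a′` to `g(a)` for every `a`. -/
def ssMatching (f : Fin n → Bool) (t : Fin m → Fin 3) : Finset (SApp' n m × SSch' n m) :=
  (Xlist n m ++ Qlist n m ++ Wlist n m).toFinset.image
      (fun a => (SApp'.base a, SSch'.base (ssAssign f t a))) ∪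
    (Xlist n m ++ Qlist n m ++ Wlist n m).toFinset.image fun a => (SApp'.p1 a, SSch'.g a)

lemma mem_ssMatching {f : Fin n → Bool} {t : Fin m → Fin 3} {a : SApp' n m} {s : SSch' n m} :
    (a, s) ∈ ssMatching f t ↔
      (∃ c, a = .base c ∧ s = .base (ssAssign f t c)) ∨ ∃ c, a = .p1 c ∧ s = .g c := by
  have hall : ∀ c : SApp n m, c ∈ (Xlist n m ++ Qlist n m ++ Wlist n m).toFinset := fun c => by
    cases c <;> simp [mem_Xlist, mem_Qlist, mem_Wlist]
  simp only [ssMatching, Finset.mem_union, Finset.mem_image, hall, true_and, Prod.mk.injEq]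
  simp only [eq_comm]

lemma ssMatching_inj {f : Fin n → Bool} {t : Fin m → Fin 3} {a b : SApp' n m} {s : SSch' n m}
    (ha : (a, s) ∈ ssMatching f t) (hb : (b, s) ∈ ssMatching f t) : a = b := by
  have := @ssAssign_injective n m f t
  rw [mem_ssMatching] at ha hb
  rcases ha with ⟨c, rfl, rfl⟩ | ⟨c, rfl, rfl⟩ <;> rcases hb with ⟨d, rfl, h⟩ | ⟨d, rfl, h⟩ <;>
    simp_all [this.eq_iff]

lemma sx_eq_s (B : E3SAT n m) (i : Fin n) (r : Fin 4) :
    ∃ j u, sx B i r = .s j u ∧ B.clause j u = (i, decide (r.1 < 2)) := by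
  unfold sx
  split_ifs with h <;> exact ⟨_, _, rfl, by simp [B.clause_occurs, h]⟩

lemma ssAssign_mem_ssPrefA (B : E3SAT n m) (f : Fin n → Bool) (t : Fin m → Fin 3)
    (a : SApp n m) : ssAssign f t a ∈ ssPrefA B a := by
  rcases a with ⟨i, r⟩ | j | ⟨j, u⟩
  · fin_cases r <;> cases h : f i <;> simp [ssAssign, ssPrefA, h]
  · generalize h : t j = u
    fin_cases u <;> simp [ssAssign, ssPrefA, h]
  · simp only [ssAssign, ssPrefA]
    split_ifs <;> simp

lemma ssCap_le_one (s : SSch n m) (p : Subj) : ssCap s p ≤ 1 := by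
  cases s <;> simp only [ssCap] <;> (try split_ifs) <;> simp

lemma ssMatching_isMatching (B : E3SAT n m) (LX1 LX2 LR1 LR2 : List (SApp' n m))
    (f : Fin n → Bool) (t : Fin m → Fin 3) :
    (ssOf' B LX1 LX2 LR1 LR2).IsMatching (ssMatching f t) := by
  refine ⟨⟨?_, ?_⟩, ?_⟩
  · rintro ⟨a, s⟩ h
    rcases mem_ssMatching.1 h with ⟨c, rfl, rfl⟩ | ⟨c, rfl, rfl⟩
    · simpa [ssOf', ssPrefA'] using ssAssign_mem_ssPrefA B f t c
    · simp [ssOf', ssPrefA']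
  · intro a s s' h h'
    rw [mem_ssMatching] at h h'
    grind
  · intro s p
    have hle : ((ssOf' B LX1 LX2 LR1 LR2).Mp (ssMatching f t) s p).card ≤ 1 :=
      Finset.card_le_one.2 fun a ha b hb =>
        ssMatching_inj (((ssOf' B LX1 LX2 LR1 LR2).mem_Mp).1 ha).1
          (((ssOf' B LX1 LX2 LR1 LR2).mem_Mp).1 hb).1
    by_cases hc : ssCap' s p = 0
    · refine (Finset.card_eq_zero.2 (Finset.eq_empty_of_forall_notMem fun a ha => ?_)).trans_le
        (Nat.zero_le _)
      obtain ⟨ha, hp⟩ := ((ssOf' B LX1 LX2 LR1 LR2).mem_Mp).1 ha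
      rcases mem_ssMatching.1 ha with ⟨c, rfl, rfl⟩ | ⟨c, rfl, rfl⟩
      · rcases c with ⟨i, r⟩ | j | ⟨j, u⟩ <;> cases p <;>
          simp only [ssOf', ssPtype', ssPtype, ssCap', ssAssign] at hc hp <;>
          (try split_ifs at hc) <;> simp_all [ssCap]
      · simp [ssCap'] at hc
    · exact hle.trans (Nat.one_le_iff_ne_zero.2 hc)

/-- An original school that an original applicant prefers to its assigned school holds an
applicant which beats it in a common subject. -/
lemma exists_occupant_of_prefers {B : E3SAT n m} {f : Fin n → Bool} {t : Fin m → Fin 3}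
    (ht : ∀ j, f (B.clause j (t j)).1 = (B.clause j (t j)).2) {a : SApp n m} {s : SSch n m}
    (hs : s ∈ ssPrefA B a)
    (hlt : (ssPrefA B a).idxOf s < (ssPrefA B a).idxOf (ssAssign f t a)) :
    ∃ b p, ssAssign f t b = s ∧ p ∈ ssPtype a ∧ p ∈ ssPtype b ∧
      ssRank' n p (.base b : SApp' n m) < ssRank' n p (.base a : SApp' n m) := by
  rcases a with ⟨i, r⟩ | j | ⟨j, u⟩
  · obtain ⟨j, u, hsx, hcl⟩ := sx_eq_s B i r
    have hne (hr : f i ≠ decide (r.1 < 2)) : ∃ b p, ssAssign f t b = .s j u ∧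
        p ∈ ssPtype (.x i r : SApp n m) ∧ p ∈ ssPtype b ∧
        ssRank' n p (.base b : SApp' n m) < ssRank' n p (.base (.x i r) : SApp' n m) := by
      refine ⟨.w j u, .F, ?_, by simp [ssPtype], by simp [ssPtype], by simp [ssRank']⟩
      have hu : u ≠ t j := by
        rintro rfl
        exact hr (by simpa [hcl] using ht j)
      simp [ssAssign, hu]
    have hi := i.2
    obtain rfl | rfl | rfl | rfl : r = 0 ∨ r = 1 ∨ r = 2 ∨ r = 3 := by omega
    all_goals cases h : f i <;> simp [ssPrefA, ssAssign, h, hsx] at hs hlt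
    · rcases hs with rfl | rfl | rfl
      · exact ⟨.x i 3, .I, by simp [ssAssign, h], by simp [ssPtype], by simp [ssPtype],
          by simp [ssRank']; omega⟩
      · exact hne (by simp [h])
      · simp at hlt
    · rcases hs with rfl | rfl | rfl
      · exact ⟨.x i 0, .F, by simp [ssAssign, h], by simp [ssPtype], by simp [ssPtype],
          by simp [ssRank']⟩
      · exact hne (by simp [h])
      · simp at hlt
    · rcases hs with rfl | rfl | rfl
      · exact ⟨.x i 3, .I, by simp [ssAssign, h], by simp [ssPtype], by simp [ssPtype],
          by simp [ssRank']; omega⟩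
      · exact hne (by simp [h])
      · simp at hlt
    · rcases hs with rfl | rfl | rfl
      · exact ⟨.x i 0, .F, by simp [ssAssign, h], by simp [ssPtype], by simp [ssPtype],
          by simp [ssRank']⟩
      · exact hne (by simp [h])
      · simp at hlt
  · obtain ⟨u, rfl⟩ : ∃ u, s = .s j u := by
      simp only [ssPrefA, List.mem_cons, List.not_mem_nil, or_false] at hs
      grind
    have hu : u ≠ t j := by
      rintro rfl
      exact lt_irrefl _ hlt
    exact ⟨.w j u, .F, by simp [ssAssign, hu], by simp [ssPtype], by simp [ssPtype],
      by simp [ssRank']⟩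
  · simp only [ssPrefA, ssAssign] at hs hlt
    split_ifs at hlt with hu
    · refine ⟨.q j, .M, ?_, by simp [ssPtype], by simp [ssPtype], by simp [ssRank']⟩
      simp only [List.mem_cons, List.not_mem_nil, or_false] at hs
      rcases hs with rfl | rfl
      · simp [ssAssign, hu]
      · simp at hlt
    · simp at hlt

theorem stmt13 {n m : ℕ} (B : E3SAT n m) (LX1 LX2 LR1 LR2 : List (SApp' n m))
    (hord : ssOrderings n m LX1 LX2 LR1 LR2)
    (f : Fin n → Bool) (hf : B.Satisfies f) :
    ∃ M' : Finset (SApp' n m × SSch' n m), (ssOf' B LX1 LX2 LR1 LR2).Stable M' := by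
  choose t ht using hf
  refine ⟨ssMatching f t, TAPSS.stable_of_occupants _ (ssRank' n)
    (fun s p => (pairwise_ssMaster' hord p).filter _)
    (ssMatching_isMatching B LX1 LX2 LR1 LR2 f t) ?_ (fun a b s => ssMatching_inj) ?_⟩
  · rintro (s | a) p
    · exact ssCap_le_one s p
    · exact le_rfl
  rintro (a | a | a) s hs hpref
  · have hmem : (SApp'.base a, SSch'.base (ssAssign f t a)) ∈ ssMatching f t :=
      mem_ssMatching.2 (.inl ⟨a, rfl, rfl⟩)
    rcases hpref with hun | ⟨s', hs', -, -, hlt⟩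
    · exact absurd hmem (hun _)
    obtain rfl : s' = .base (ssAssign f t a) := by
      rw [mem_ssMatching] at hs'
      grind
    have hinj : Function.Injective (SSch'.base : SSch n m → SSch' n m) :=
      fun _ _ h => SSch'.base.inj h
    have ha := ssAssign_mem_ssPrefA B f t a
    obtain ⟨s, rfl⟩ | rfl : (∃ c, s = .base c) ∨ s = .g a := by
      simp only [ssOf', ssPrefA', List.mem_append, List.mem_map, List.mem_singleton] at hs
      grind
    · have hs' : s ∈ ssPrefA B a := by simpa [ssOf', ssPrefA'] using hs
      simp only [ssOf', ssPrefA'] at hlt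
      rw [List.idxOf_append_of_mem (List.mem_map_of_mem hs'),
        List.idxOf_append_of_mem (List.mem_map_of_mem ha), idxOf_map hinj, idxOf_map hinj] at hlt
      obtain ⟨b, p, rfl, hpa, hpb, hr⟩ := exists_occupant_of_prefers ht hs' hlt
      exact ⟨.base b, p, mem_ssMatching.2 (.inl ⟨b, rfl, rfl⟩), hpa, hpb, hr⟩
    · simp only [ssOf', ssPrefA'] at hlt
      rw [List.idxOf_append_of_notMem (by simp),
        List.idxOf_append_of_mem (List.mem_map_of_mem ha)] at hlt
      have := List.idxOf_lt_length_of_mem (List.mem_map_of_mem (f := SSch'.base) ha)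
      omega
  · obtain rfl : s = .g a := by simpa [ssOf', ssPrefA'] using hs
    have hmem : (SApp'.p1 a, SSch'.g a) ∈ ssMatching f t := mem_ssMatching.2 (.inr ⟨a, rfl, rfl⟩)
    rcases hpref with hun | ⟨s', hs', -, -, hlt⟩
    · exact absurd hmem (hun _)
    · obtain rfl : s' = .g a := by
        rw [mem_ssMatching] at hs'
        grind
      exact absurd hlt (lt_irrefl _)
  · have hs : s = .g a := by simpa [ssOf', ssPrefA'] using hs
    subst hs
    have hmem : (SApp'.p1 a, SSch'.g a) ∈ ssMatching f t := mem_ssMatching.2 (.inr ⟨a, rfl, rfl⟩)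
    rcases a with ⟨i, r⟩ | j | ⟨j, u⟩
    · exact ⟨_, .M, hmem, by simp [ssOf', ssPtype'], by simp [ssOf', ssPtype'], by simp [ssRank']⟩
    · exact ⟨_, .I, hmem, by simp [ssOf', ssPtype'], by simp [ssOf', ssPtype'], by simp [ssRank']⟩
    · exact ⟨_, .I, hmem, by simp [ssOf', ssPtype'], by simp [ssOf', ssPtype'], by simp [ssRank']⟩
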